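/- arXiv:1712.01502 — 2 statements merged into one kernel-verified Lean document; each statement's English description precedes it below -/
import Mathlib

section
/- (Localization, local form.) In the standing setting, the polynomial entropy of f satisfies h_pol(f) = sup { h^loc_pol(f; S) : S a nonempty finite subset of X∖{∞} }. -/
open Filter Topology Set
open scoped ENNReal

/-- `E` is `(n, ε)`-separated for `f`: any two distinct points of `E` are `ε`-apart at some
time `k ∈ {0, …, n-1}`. -/
def IsDynSeparated {X : Type*} [MetricSpace X] (f : X → X) (n : ℕ) (ε : ℝ) (E : Set X) : Prop :=
  ∀ x ∈ E, ∀ y ∈ E, x ≠ y → ∃ k < n, ε < dist (f^[k] x) (f^[k] y)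

/-- `S(n, ε)`: the maximal cardinality of an `(n, ε)`-separated set. -/
noncomputable def maxSep {X : Type*} [MetricSpace X] (f : X → X) (n : ℕ) (ε : ℝ) : ℕ :=
  sSup {m | ∃ E : Finset X, IsDynSeparated f n ε ↑E ∧ E.card = m}

/-- Polynomial entropy `h_pol(f) = lim_{ε → 0} limsup_n (log S(n,ε) / log n)`, a value in
`[0, ∞]`.  Since `ε ↦ limsup_n (log S(n,ε) / log n)` is nonincreasing in `ε`, the limit as
`ε → 0⁺` is the supremum over `ε > 0`. -/
noncomputable def polEntropy {X : Type*} [MetricSpace X] (f : X → X) : ℝ≥0∞ :=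
  ⨆ (ε : ℝ) (_ : 0 < ε),
    Filter.atTop.limsup fun n : ℕ =>
      ENNReal.ofReal (Real.log (maxSep f n ε) / Real.log n)

/-- Topological entropy `h_top(f) = lim_{ε → 0} limsup_n (1/n) log S(n,ε)`. -/
noncomputable def topEntropy {X : Type*} [MetricSpace X] (f : X → X) : ℝ≥0∞ :=
  ⨆ (ε : ℝ) (_ : 0 < ε),
    Filter.atTop.limsup fun n : ℕ =>
      ENNReal.ofReal (Real.log (maxSep f n ε) / n)

/-- The set `A_n(ℱ)` of codings of orbit segments of length `n` relative to the finite
family `ℱ`: words `w` with letters in `ℱ ∪ {∞_ℱ}` (where `∞_ℱ` is the complement of `∪ℱ`)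
for which some orbit segment `(x, f x, …, f^{n-1} x)` satisfies `f^k x ∈ w k` for all `k`. -/
def codings {X : Type*} (f : X → X) (F : Finset (Set X)) (n : ℕ) : Set (Fin n → Set X) :=
  {w | (∀ k, w k ∈ F ∨ w k = (⋃₀ (F : Set (Set X)))ᶜ) ∧
      ∃ x : X, ∀ k : Fin n, f^[(k : ℕ)] x ∈ w k}

/-- Coding polynomial entropy of a finite family: `h_pol(f; ℱ) = limsup_n log #A_n(ℱ) / log n`.
For a single set `Y`, `h_pol(f; Y)` is `codingEntropy f {Y}`. -/
noncomputable def codingEntropy {X : Type*} (f : X → X) (F : Finset (Set X)) : ℝ≥0∞ :=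
  Filter.atTop.limsup fun n : ℕ =>
    ENNReal.ofReal (Real.log ((codings f F n).ncard) / Real.log n)

/-- The `n`-th iterate of a homeomorphism, for `n : ℤ`. -/
def zIter {X : Type*} [TopologicalSpace X] (f : X ≃ₜ X) (n : ℤ) (x : X) : X :=
  (f.toEquiv ^ n) x

/-- A set `Z` is wandering if `f^n(Z) ∩ Z = ∅` for every integer `n ≠ 0`. -/
def IsWanderingSet {X : Type*} [TopologicalSpace X] (f : X ≃ₜ X) (Z : Set X) : Prop :=
  ∀ n : ℤ, n ≠ 0 → zIter f n '' Z ∩ Z = ∅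

/-- Standing setting: `p` (the point written `∞` in the paper) is a fixed point of `f`, and
every other point is wandering, i.e. has a wandering neighborhood. -/
def StandingSetting {X : Type*} [TopologicalSpace X] (f : X ≃ₜ X) (p : X) : Prop :=
  f p = p ∧ ∀ x : X, x ≠ p → ∃ U ∈ 𝓝 x, IsWanderingSet f U

/-- `M(Y) = sup_{x ∈ X} #{n ∈ ℤ : f^n(x) ∈ Y}`. -/
noncomputable def orbitCount {X : Type*} [TopologicalSpace X] (f : X ≃ₜ X) (Y : Set X) : ℕ∞ :=
  ⨆ x : X, {n : ℤ | zIter f n x ∈ Y}.encard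

/-- Local polynomial entropy `h^loc_pol(f; S)` of a finite set `S`: the limit, along
decreasing neighborhood bases of the points of `S`, of the coding entropies of the
corresponding families of neighborhoods.  By monotonicity of the coding entropy this limit
equals the infimum of `h_pol(f; {U x : x ∈ S})` over all families `U` of respective
neighborhoods of the points of `S` such that `M(⋃_{x ∈ S} U x) < ∞` (such families exist,
and any decreasing neighborhood basis eventually consists of such sets). -/
noncomputable def localEntropy {X : Type*} [TopologicalSpace X] (f : X ≃ₜ X)
    (S : Finset X) : ℝ≥0∞ :=
  letI := Classical.decEq (Set X)
  ⨅ (U : X → Set X) (_ : ∀ x ∈ S, U x ∈ 𝓝 x)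
    (_ : orbitCount f (⋃ x ∈ S, U x) < ⊤),
    codingEntropy ⇑f (S.image U)

/-- The family `U` of sets (indexed by the points of `S`) is mutually singular: for every
`M` there are a point `x` and times `(N a)_{a ∈ S}` with `f^{N a}(x) ∈ U a` for all `a ∈ S`
and `|N a - N b| > M` for all `a ≠ b` in `S`. -/
def MutuallySingularFam {X : Type*} [TopologicalSpace X] (f : X ≃ₜ X) (S : Finset X)
    (U : X → Set X) : Prop :=
  ∀ M : ℕ, ∃ (x : X) (N : X → ℤ),
    (∀ a ∈ S, zIter f (N a) x ∈ U a) ∧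
    ∀ a ∈ S, ∀ b ∈ S, a ≠ b → (M : ℤ) < |N a - N b|

/-- A finite set `S` is singular if every family of respective neighborhoods of its points
is mutually singular. -/
def IsSingularSet {X : Type*} [TopologicalSpace X] (f : X ≃ₜ X) (S : Finset X) : Prop :=
  ∀ U : X → Set X, (∀ a ∈ S, U a ∈ 𝓝 a) → MutuallySingularFam f S U

/-- The polynomial growth rate of a finite sum of sequences with constant weights is at most the
largest of the individual rates. -/
lemma limsup_log_div_log_le_of_le_sum {ι : Type*} (T : Finset ι) (C : ι → ℕ) (a : ι → ℕ → ℕ)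
    (b : ℕ → ℕ) (L : ℝ≥0∞) (hb : ∀ n, b n ≤ ∑ s ∈ T, C s * a s n)
    (ha : ∀ s ∈ T, atTop.limsup (fun n : ℕ =>
      ENNReal.ofReal (Real.log (a s n) / Real.log n)) ≤ L) :
    atTop.limsup (fun n : ℕ => ENNReal.ofReal (Real.log (b n) / Real.log n)) ≤ L := by
  refine le_of_forall_gt_imp_ge_of_dense fun c hc => ?_
  rcases eq_or_ne c ⊤ with rfl | hctop
  · exact le_top
  lift c to NNReal using hctop
  have hlog : Tendsto (fun n : ℕ => Real.log n) atTop atTop :=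
    Real.tendsto_log_atTop.comp tendsto_natCast_atTop_atTop
  have hev : ∀ᶠ n : ℕ in atTop, ∀ s ∈ T,
      ENNReal.ofReal (Real.log (a s n) / Real.log n) < c :=
    (Finset.eventually_all T).2 fun s hs =>
      eventually_lt_of_limsup_lt (lt_of_le_of_lt (ha s hs) hc)
  have hpow : ∀ᶠ n : ℕ in atTop, ∀ s ∈ T, (a s n : ℝ) ≤ Real.exp (c * Real.log n) := by
    filter_upwards [hev, hlog.eventually_gt_atTop 0] with n hn hpos s hs
    rcases Nat.eq_zero_or_pos (a s n) with h0 | h0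
    · rw [h0, Nat.cast_zero]
      exact (Real.exp_pos _).le
    · rw [← Real.log_le_iff_le_exp (by exact_mod_cast h0), ← div_le_iff₀ hpos]
      have h := (hn s hs).le
      rw [← ENNReal.ofReal_coe_nnreal] at h
      exact (ENNReal.ofReal_le_ofReal_iff c.2).1 h
  set D : ℝ := ((∑ s ∈ T, C s : ℕ) : ℝ) + 1 with hD
  have hD1 : 1 ≤ D := by
    rw [hD]
    exact le_add_of_nonneg_left (Nat.cast_nonneg _)
  have hbound : ∀ᶠ n : ℕ in atTop, ENNReal.ofReal (Real.log (b n) / Real.log n) ≤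
      ENNReal.ofReal (Real.log D / Real.log n + c) := by
    filter_upwards [hpow, hlog.eventually_gt_atTop 0] with n hn hpos
    refine ENNReal.ofReal_le_ofReal ?_
    rw [div_add' _ _ _ hpos.ne']
    refine div_le_div_of_nonneg_right ?_ hpos.le
    rcases Nat.eq_zero_or_pos (b n) with h0 | h0
    · rw [h0, Nat.cast_zero, Real.log_zero]
      exact add_nonneg (Real.log_nonneg hD1) (mul_nonneg c.2 hpos.le)
    · have hle : (b n : ℝ) ≤ D * Real.exp (c * Real.log n) := by
        calc (b n : ℝ) ≤ ((∑ s ∈ T, C s * a s n : ℕ) : ℝ) := by exact_mod_cast hb n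
          _ = ∑ s ∈ T, (C s : ℝ) * a s n := by push_cast; rfl
          _ ≤ ∑ s ∈ T, (C s : ℝ) * Real.exp (c * Real.log n) :=
            Finset.sum_le_sum fun s hs => mul_le_mul_of_nonneg_left (hn s hs) (Nat.cast_nonneg _)
          _ = (∑ s ∈ T, (C s : ℝ)) * Real.exp (c * Real.log n) := by rw [Finset.sum_mul]
          _ ≤ D * Real.exp (c * Real.log n) := by
            refine mul_le_mul_of_nonneg_right ?_ (Real.exp_pos _).le
            rw [hD]
            push_cast
            linarith
      calc Real.log (b n) ≤ Real.log (D * Real.exp (c * Real.log n)) :=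
            Real.log_le_log (by exact_mod_cast h0) hle
        _ = Real.log D + c * Real.log n := by
            rw [Real.log_mul (by positivity) (Real.exp_pos _).ne', Real.log_exp]
  have hlim : Tendsto (fun n : ℕ => ENNReal.ofReal (Real.log D / Real.log n + c)) atTop
      (𝓝 (c : ℝ≥0∞)) := by
    have h : Tendsto (fun n : ℕ => Real.log D / Real.log n + c) atTop (𝓝 (0 + (c : ℝ))) :=
      (hlog.const_div_atTop _).add_const _
    rw [zero_add] at h
    simpa using ENNReal.tendsto_ofReal h
  exact (limsup_le_limsup hbound).trans hlim.limsup_eq.le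

/-- The words with letters in `A` on `J` and constant letter `a` off `J`. -/
def wordsSupportedOn {α : Type*} {n : ℕ} (A : Finset α) (a : α) (J : Set (Fin n)) :
    Set (Fin n → α) :=
  {w | (∀ k, w k ∈ A) ∧ ∀ k ∉ J, w k = a}

lemma exists_finset_wordsSupportedOn {α : Type*} {n m : ℕ} {A : Finset α} {a : α} (ha : a ∈ A)
    {J : Set (Fin n)} (hJ : J.encard ≤ m) :
    ∃ P : Finset (Fin n → α), (∀ w ∈ wordsSupportedOn A a J, w ∈ P) ∧ P.card ≤ A.card ^ m := by
  classical
  refine ⟨Fintype.piFinset fun k => if k ∈ J then A else {a}, fun w hw => ?_, ?_⟩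
  · rw [Fintype.mem_piFinset]
    intro k
    split_ifs with hk
    · exact hw.1 k
    · exact Finset.mem_singleton.2 (hw.2 k hk)
  · rw [Fintype.card_piFinset]
    have h : ∀ k, (if k ∈ J then A else {a}).card = if k ∈ J then A.card else 1 := by
      intro k
      split_ifs <;> simp
    simp_rw [h]
    rw [Finset.prod_ite]
    simp only [Finset.prod_const, one_pow, mul_one]
    refine Nat.pow_le_pow_right (Finset.card_pos.2 ⟨a, ha⟩) ?_
    have h2 : J = (Finset.univ.filter fun k => k ∈ J : Finset (Fin n)) := by
      ext k
      simp
    rw [h2, Set.encard_coe_eq_coe_finsetCard] at hJ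
    exact_mod_cast hJ

/-- A set of words covered by sets `wordsSupportedOn A a (J b)`, `b ∈ B`, has at most
`B.card * A.card ^ m` elements if every `J b` has at most `m` elements. -/
lemma ncard_le_card_mul_pow {α β : Type*} {n m : ℕ} {A : Finset α} {a : α} (ha : a ∈ A)
    (B : Finset β) (J : β → Set (Fin n)) (hJ : ∀ b ∈ B, (J b).encard ≤ m)
    (W : Set (Fin n → α)) (hW : ∀ w ∈ W, ∃ b ∈ B, w ∈ wordsSupportedOn A a (J b)) :
    W.ncard ≤ B.card * A.card ^ m := by
  classical
  have h : ∀ b, ∃ P : Finset (Fin n → α), b ∈ B →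
      (∀ w ∈ wordsSupportedOn A a (J b), w ∈ P) ∧ P.card ≤ A.card ^ m := by
    intro b
    by_cases hb : b ∈ B
    · obtain ⟨P, hP⟩ := exists_finset_wordsSupportedOn ha (hJ b hb)
      exact ⟨P, fun _ => hP⟩
    · exact ⟨∅, fun hb' => absurd hb' hb⟩
  choose P hP using h
  have hsub : W ⊆ (B.biUnion P : Finset (Fin n → α)) := by
    intro w hw
    obtain ⟨b, hb, hwb⟩ := hW w hw
    exact Finset.mem_coe.2 (Finset.mem_biUnion.2 ⟨b, hb, (hP b hb).1 w hwb⟩)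
  calc W.ncard ≤ (B.biUnion P).card := by
        rw [← Set.ncard_coe_finset]
        exact Set.ncard_le_ncard hsub (Finset.finite_toSet _)
    _ ≤ B.card * A.card ^ m := Finset.card_biUnion_le_card_mul _ _ _ fun b hb => (hP b hb).2

section Codings

variable {X : Type*}

lemma codings_finite (f : X → X) (F : Finset (Set X)) (n : ℕ) : (codings f F n).Finite := by
  classical
  refine (Finset.finite_toSet
    (Fintype.piFinset fun _ : Fin n => insert ((⋃₀ (F : Set (Set X)))ᶜ) F)).subset ?_
  intro w hw
  rw [Finset.mem_coe, Fintype.mem_piFinset]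
  exact fun k => Finset.mem_insert.2 (hw.1 k).symm

lemma exists_mem_codings (f : X → X) (F : Finset (Set X)) (n : ℕ) (x : X) :
    ∃ w ∈ codings f F n, ∀ k : Fin n, f^[(k : ℕ)] x ∈ w k := by
  have h : ∀ k : Fin n, ∃ Y : Set X,
      (Y ∈ F ∨ Y = (⋃₀ (F : Set (Set X)))ᶜ) ∧ f^[(k : ℕ)] x ∈ Y := by
    intro k
    by_cases hk : f^[(k : ℕ)] x ∈ ⋃₀ (F : Set (Set X))
    · obtain ⟨Y, hY, hxY⟩ := hk
      exact ⟨Y, Or.inl hY, hxY⟩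
    · exact ⟨_, Or.inr rfl, hk⟩
  choose w hw using h
  exact ⟨w, ⟨fun k => (hw k).1, x, fun k => (hw k).2⟩, fun k => (hw k).2⟩

end Codings

section OrbitCount

variable {X : Type*} [TopologicalSpace X]

lemma zIter_natCast (f : X ≃ₜ X) (n : ℕ) (x : X) : zIter f n x = f^[n] x := by
  rw [zIter, zpow_natCast, Equiv.Perm.coe_pow]
  rfl

lemma IsWanderingSet.eq_of_mem {f : X ≃ₜ X} {Z : Set X} (hZ : IsWanderingSet f Z) {x : X}
    {m n : ℤ} (hm : zIter f m x ∈ Z) (hn : zIter f n x ∈ Z) : m = n := by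
  by_contra hne
  have h : zIter f n x ∈ zIter f (n - m) '' Z ∩ Z := by
    refine ⟨⟨_, hm, ?_⟩, hn⟩
    rw [zIter, zIter, ← Equiv.Perm.mul_apply, ← zpow_add, sub_add_cancel]
    rfl
  rw [hZ _ (sub_ne_zero.2 (Ne.symm hne))] at h
  exact h

lemma orbitCount_le_card (f : X ≃ₜ X) {ι : Type*} (s : Finset ι) (W : ι → Set X)
    (hW : ∀ i ∈ s, IsWanderingSet f (W i)) {K : Set X} (hK : K ⊆ ⋃ i ∈ s, W i) :
    orbitCount f K ≤ s.card := by
  refine iSup_le fun x => ?_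
  have h : ∀ n : ℤ, zIter f n x ∈ K → ∃ i ∈ s, zIter f n x ∈ W i := by
    intro n hn
    simpa using hK hn
  rcases Set.eq_empty_or_nonempty {n : ℤ | zIter f n x ∈ K} with h0 | ⟨n₀, hn₀⟩
  · rw [h0, Set.encard_empty]
    exact bot_le
  obtain ⟨i₀, -⟩ := h n₀ hn₀
  have : Nonempty ι := ⟨i₀⟩
  choose! i hi hiW using h
  rw [← Set.encard_coe_eq_coe_finsetCard]
  refine Set.encard_le_encard_of_injOn (f := i) (fun n hn => hi n hn) ?_
  intro m hm n hn hmn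
  refine (hW _ (hi m hm)).eq_of_mem (hiW m hm) ?_
  rw [hmn]
  exact hiW n hn

lemma encard_visits_le_orbitCount (f : X ≃ₜ X) (Y : Set X) (x : X) (n : ℕ) :
    {k : Fin n | f^[(k : ℕ)] x ∈ Y}.encard ≤ orbitCount f Y := by
  refine le_trans ?_ (le_iSup (fun x : X => {n : ℤ | zIter f n x ∈ Y}.encard) x)
  refine Set.encard_le_encard_of_injOn (f := fun k : Fin n => ((k : ℕ) : ℤ)) ?_ ?_
  · intro k hk
    simpa [zIter_natCast] using hk
  · intro k _ l _ hkl
    exact Fin.ext (Int.ofNat_inj.1 hkl)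

lemma StandingSetting.exists_orbitCount_le {f : X ≃ₜ X} {p : X} (hst : StandingSetting f p)
    {K : Set X} (hK : IsCompact K) (hpK : p ∉ K) : ∃ m : ℕ, orbitCount f K ≤ m := by
  have h : ∀ x ∈ K, ∃ U ∈ 𝓝 x, IsWanderingSet f U := fun x hx =>
    hst.2 x fun hxp => hpK (hxp ▸ hx)
  choose! W hWn hW using h
  obtain ⟨s, hsK, hs⟩ := hK.elim_nhds_subcover W hWn
  exact ⟨s.card, orbitCount_le_card f s W (fun i hi => hW i (hsK i hi)) hs⟩

end OrbitCount

section Separated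

variable {X : Type*} [MetricSpace X]

lemma exists_card_le_of_isDynSeparated [CompactSpace X] {f : X → X} (hf : Continuous f) (n : ℕ)
    {ε : ℝ} (hε : 0 < ε) : ∃ N : ℕ, ∀ E : Finset X, IsDynSeparated f n ε ↑E → E.card ≤ N := by
  classical
  let V : X → Set X := fun x => ⋂ k ∈ Finset.range n, {y | dist (f^[k] y) (f^[k] x) < ε / 2}
  have hV : ∀ x ∈ (univ : Set X), V x ∈ 𝓝 x := by
    intro x _
    refine (biInter_finset_mem _).2 fun k _ => ?_
    refine (isOpen_lt ((hf.iterate k).dist continuous_const) continuous_const).mem_nhds ?_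
    simpa using half_pos hε
  obtain ⟨s, -, hs⟩ := isCompact_univ.elim_nhds_subcover V hV
  have h : ∀ x : X, ∃ y ∈ s, x ∈ V y := fun x => by simpa using hs (mem_univ x)
  choose c hcs hc using h
  refine ⟨s.card, fun E hE => Finset.card_le_card_of_injOn c (fun x _ => hcs x) ?_⟩
  intro x hx y hy hxy
  by_contra hne
  obtain ⟨k, hk, hlt⟩ := hE x hx y hy hne
  have hx' := hc x
  have hy' := hc y
  rw [← hxy] at hy'
  simp only [V, mem_iInter, Finset.mem_range, mem_ofPred_eq] at hx' hy'
  have := dist_triangle_right (f^[k] x) (f^[k] y) (f^[k] (c x))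
  linarith [hx' k hk, hy' k hk]

lemma exists_isDynSeparated_card_eq_maxSep [CompactSpace X] {f : X → X} (hf : Continuous f)
    (n : ℕ) {ε : ℝ} (hε : 0 < ε) :
    ∃ E : Finset X, IsDynSeparated f n ε ↑E ∧ E.card = maxSep f n ε ∧
      ∀ x, ∃ e ∈ E, ∀ k < n, dist (f^[k] x) (f^[k] e) ≤ ε := by
  classical
  obtain ⟨N, hN⟩ := exists_card_le_of_isDynSeparated hf n hε
  have hbdd : BddAbove {m | ∃ E : Finset X, IsDynSeparated f n ε ↑E ∧ E.card = m} := by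
    refine ⟨N, ?_⟩
    rintro _ ⟨E, hE, rfl⟩
    exact hN E hE
  have hne : {m | ∃ E : Finset X, IsDynSeparated f n ε ↑E ∧ E.card = m}.Nonempty :=
    ⟨0, ∅, by simp [IsDynSeparated], rfl⟩
  obtain ⟨E, hE, hcard⟩ := Nat.sSup_mem hne hbdd
  refine ⟨E, hE, hcard, fun x => ?_⟩
  by_contra! hx
  have hxE : x ∉ E := by
    intro hxE
    obtain ⟨k, -, hk⟩ := hx x hxE
    rw [dist_self] at hk
    exact absurd hk hε.not_gt
  have hsep : IsDynSeparated f n ε ↑(insert x E) := by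
    intro y hy z hz hyz
    rw [Finset.mem_coe, Finset.mem_insert] at hy hz
    rcases hy with rfl | hy <;> rcases hz with rfl | hz
    · exact absurd rfl hyz
    · exact hx z hz
    · obtain ⟨k, hk, hlt⟩ := hx y hy
      exact ⟨k, hk, by rwa [dist_comm]⟩
    · exact hE y hy z hz hyz
  have hle : (insert x E).card ≤ maxSep f n ε := le_csSup hbdd ⟨_, hsep, rfl⟩
  rw [Finset.card_insert_of_notMem hxE, hcard] at hle
  exact absurd hle (Nat.not_succ_le_self _)

end Separated

lemma exists_tuple_covering {X : Type*} {M : ℕ} {K : Set X} (hK : K.Nonempty) (D : Finset X)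
    (hD : ∀ x ∈ D, x ∈ K) (hcard : D.card ≤ M) :
    ∃ t : Fin M → X, (∀ i, t i ∈ K) ∧ ∀ x ∈ D, ∃ i, t i = x := by
  obtain ⟨y, hy⟩ := hK
  refine ⟨fun i => D.toList.getD i y, fun i => ?_, fun x hx => ?_⟩
  · by_cases hi : (i : ℕ) < D.toList.length
    · simp only [List.getD_eq_getElem _ _ hi]
      exact hD _ (Finset.mem_toList.1 (List.getElem_mem hi))
    · simp only [List.getD_eq_default _ _ (not_lt.1 hi)]
      exact hy
  · obtain ⟨i, hi, hix⟩ := List.getElem_of_mem (Finset.mem_toList.2 hx)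
    refine ⟨⟨i, ?_⟩, ?_⟩
    · rw [Finset.length_toList] at hi
      exact hi.trans_le hcard
    · exact (List.getD_eq_getElem _ _ hi).trans hix

section Localization

variable {X : Type*} [MetricSpace X] [CompactSpace X]

lemma localEntropy_le_polEntropy (f : X ≃ₜ X) {p : X} (hst : StandingSetting f p) (S : Finset X)
    (hS : ∀ x ∈ S, x ≠ p) : localEntropy f S ≤ polEntropy ⇑f := by
  let _ := Classical.decEq (Set X)
  have h : ∀ x ∈ S, ∃ U ∈ 𝓝 x, IsWanderingSet f U := fun x hx => hst.2 x (hS x hx)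
  choose! W hWn hW using h
  obtain ⟨r, hr, hrW⟩ : ∃ r : ℝ, 0 < r ∧ ∀ x ∈ S, Metric.ball x (r + r) ⊆ W x := by
    have hev : ∀ᶠ r : ℝ in 𝓝[>] 0, ∀ x ∈ S, Metric.ball x (r + r) ⊆ W x := by
      refine (Finset.eventually_all S).2 fun x hx => ?_
      obtain ⟨δ, hδ, hball⟩ := Metric.mem_nhds_iff.1 (hWn x hx)
      filter_upwards [Ioo_mem_nhdsGT (half_pos hδ)] with r hr
      exact (Metric.ball_subset_ball (by linarith [hr.2])).trans hball
    obtain ⟨r, hr, hr0⟩ := (hev.and self_mem_nhdsWithin).exists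
    exact ⟨r, hr0, hr⟩
  let U : X → Set X := fun x => Metric.ball x r
  have hUW : ⋃ x ∈ S, U x ⊆ ⋃ x ∈ S, W x := iUnion₂_mono fun x hx =>
    (Metric.ball_subset_ball (by linarith)).trans (hrW x hx)
  have hfin : orbitCount f (⋃ x ∈ S, U x) < ⊤ :=
    (orbitCount_le_card f S W hW hUW).trans_lt (ENat.natCast_lt_top _)
  have hle : localEntropy f S ≤ codingEntropy ⇑f (S.image U) :=
    iInf₂_le_of_le U (fun x _ => Metric.ball_mem_nhds x hr) (iInf_le _ hfin)
  refine hle.trans (le_trans ?_ (le_iSup₂ (f := fun (ε : ℝ) (_ : 0 < ε) =>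
    Filter.atTop.limsup fun n : ℕ =>
      ENNReal.ofReal (Real.log (maxSep f n ε) / Real.log n)) r hr))
  set A : Finset (Set X) := insert ((⋃₀ ((S.image U : Finset (Set X)) : Set (Set X)))ᶜ)
    (S.image U)
  refine limsup_log_div_log_le_of_le_sum {()} (fun _ => A.card ^ S.card)
    (fun _ n => maxSep f n r) _ _ (fun n => ?_) (fun _ _ => le_rfl)
  obtain ⟨E, -, hEcard, hE⟩ := exists_isDynSeparated_card_eq_maxSep f.continuous n hr
  rw [Finset.sum_singleton, mul_comm, ← hEcard]
  refine ncard_le_card_mul_pow (A := A) (Finset.mem_insert_self _ _) E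
    (fun e => {k : Fin n | (⇑f)^[(k : ℕ)] e ∈ ⋃ x ∈ S, W x})
    (fun e _ => (encard_visits_le_orbitCount f _ e n).trans
      (orbitCount_le_card f S W hW Subset.rfl)) _ ?_
  rintro w ⟨hw, x, hx⟩
  obtain ⟨e, he, hxe⟩ := hE x
  refine ⟨e, he, fun k => Finset.mem_insert.2 (hw k).symm, fun k hk => ?_⟩
  refine (hw k).resolve_left fun hwk => hk ?_
  obtain ⟨a, ha, hwa⟩ := Finset.mem_image.1 hwk
  have hxa := hx k
  rw [← hwa] at hxa
  refine mem_iUnion₂.2 ⟨a, ha, hrW a ha ?_⟩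
  have h1 := hxe k k.2
  rw [Metric.mem_ball] at hxa ⊢
  have := dist_triangle_left ((⇑f)^[(k : ℕ)] e) a ((⇑f)^[(k : ℕ)] x)
  linarith

/-- If every orbit segment meets `K` inside the union of one of finitely many families with finite
orbit count, and off `K` any two points are `ε`-close, then the growth of separated sets is
controlled by the coding entropies of these families. -/
lemma limsup_maxSep_le_of_codings (f : X ≃ₜ X) {ε : ℝ} (hε : 0 < ε) {K : Set X}
    (hK : IsCompact K) (hKε : ∀ x ∉ K, ∀ y ∉ K, dist x y ≤ ε) {ι : Type*} (T : Finset ι)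
    (F : ι → Finset (Set X)) (hF : ∀ s ∈ T, orbitCount f (⋃₀ (F s : Set (Set X))) < ⊤)
    (hT : ∀ (n : ℕ) (x : X), ∃ s ∈ T, ∀ k < n,
      (⇑f)^[k] x ∈ K → (⇑f)^[k] x ∈ ⋃₀ (F s : Set (Set X)))
    {c : ℝ≥0∞} (hc : ∀ s ∈ T, codingEntropy ⇑f (F s) ≤ c) :
    atTop.limsup (fun n : ℕ => ENNReal.ofReal (Real.log (maxSep f n ε) / Real.log n)) ≤ c := by
  classical
  obtain ⟨Q, -, hQ⟩ := hK.elim_nhds_subcover (fun x => Metric.ball x (ε / 2))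
    fun x _ => Metric.ball_mem_nhds x (half_pos hε)
  have hq : ∀ x : X, ∃ a : Option X, a ∈ insert none (Q.image some) ∧ (a = none ↔ x ∉ K) ∧
      ∀ y, a = some y → dist x y < ε / 2 := by
    intro x
    by_cases hx : x ∈ K
    · obtain ⟨y, hy, hxy⟩ := mem_iUnion₂.1 (hQ hx)
      refine ⟨some y, by simp [hy], by simp [hx], ?_⟩
      rintro _ ⟨⟩
      exact hxy
    · exact ⟨none, by simp, by simp [hx], by simp⟩
  choose q hqQ hqK hqd using hq
  have hqε : ∀ x y, q x = q y → dist x y ≤ ε := by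
    intro x y hxy
    cases h : q x with
    | none => exact hKε x ((hqK x).1 h) y ((hqK y).1 (hxy ▸ h))
    | some z =>
      have h1 := hqd x z h
      have h2 := hqd y z (hxy ▸ h)
      linarith [dist_triangle_right x y z]
  have hm : ∀ s, ∃ m : ℕ, s ∈ T → orbitCount f (⋃₀ (F s : Set (Set X))) ≤ m := by
    intro s
    by_cases hs : s ∈ T
    · obtain ⟨m, hm⟩ := ENat.ne_top_iff_exists.1 (hF s hs).ne
      exact ⟨m, fun _ => hm.ge⟩
    · exact ⟨0, fun h => absurd h hs⟩
  choose m hm using hm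
  set A : Finset (Option X) := insert none (Q.image some)
  refine limsup_log_div_log_le_of_le_sum T (fun s => A.card ^ m s)
    (fun s n => (codings f (F s) n).ncard) _ _ (fun n => ?_) hc
  obtain ⟨E, hEsep, hEcard, -⟩ := exists_isDynSeparated_card_eq_maxSep f.continuous n hε
  let g : X → Fin n → Option X := fun x k => q ((⇑f)^[(k : ℕ)] x)
  have hg : InjOn g E := by
    intro x hx y hy hxy
    by_contra hne
    obtain ⟨k, hk, hlt⟩ := hEsep x hx y hy hne
    exact absurd (hqε _ _ (congrFun hxy ⟨k, hk⟩)) (not_le.2 hlt)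
  choose σ hσT hσ using hT n
  have hEsum : E.card = ∑ s ∈ T, (E.filter fun x => σ x = s).card :=
    Finset.card_eq_sum_card_fiberwise fun x _ => hσT x
  rw [← hEcard, hEsum]
  refine Finset.sum_le_sum fun s hs => ?_
  have hinj : InjOn g (E.filter fun x => σ x = s : Finset X) :=
    hg.mono (Finset.coe_subset.2 (Finset.filter_subset _ _))
  rw [mul_comm, Set.ncard_eq_toFinset_card _ (codings_finite _ _ _),
    ← Set.ncard_coe_finset, ← hinj.ncard_image]
  refine ncard_le_card_mul_pow (A := A) (Finset.mem_insert_self _ _) _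
    (fun u => {k : Fin n | u k ≠ (⋃₀ (F s : Set (Set X)))ᶜ}) ?_ _ ?_
  · intro u hu
    obtain ⟨hu, x, hx⟩ := (Set.Finite.mem_toFinset _).1 hu
    refine le_trans (Set.encard_le_encard fun k hk => ?_)
      ((encard_visits_le_orbitCount f _ x n).trans (hm s hs))
    exact ⟨u k, (hu k).resolve_right hk, hx k⟩
  · rintro _ ⟨x, hx, rfl⟩
    have hxs : σ x = s := (Finset.mem_filter.1 (Finset.mem_coe.1 hx)).2
    obtain ⟨u, hu, hxu⟩ := exists_mem_codings (⇑f) (F s) n x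
    refine ⟨u, (Set.Finite.mem_toFinset _).2 hu, fun k => hqQ _, fun k hk => ?_⟩
    refine (hqK _).2 fun hxK => ?_
    have h1 := hσ x k k.2 hxK
    rw [hxs] at h1
    have h2 := hxu k
    rw [not_not.1 hk] at h2
    exact h2 h1

lemma limsup_maxSep_le_of_localEntropy_lt (f : X ≃ₜ X) {p : X} (hst : StandingSetting f p)
    {ε : ℝ} (hε : 0 < ε) {c : ℝ≥0∞}
    (hc : ∀ S : Finset X, S.Nonempty → (∀ x ∈ S, x ≠ p) → localEntropy f S < c) :
    atTop.limsup (fun n : ℕ => ENNReal.ofReal (Real.log (maxSep f n ε) / Real.log n)) ≤ c := by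
  classical
  let _ := Classical.decEq (Set X)
  set K : Set X := (Metric.ball p (ε / 2))ᶜ
  have hK : IsCompact K := Metric.isOpen_ball.isClosed_compl.isCompact
  have hpK : p ∉ K := fun h => h (Metric.mem_ball_self (half_pos hε))
  have hKε : ∀ x ∉ K, ∀ y ∉ K, dist x y ≤ ε := by
    intro x hx y hy
    have hx' : dist x p < ε / 2 := not_not.1 hx
    have hy' : dist y p < ε / 2 := not_not.1 hy
    linarith [dist_triangle_right x y p]
  rcases K.eq_empty_or_nonempty with hK0 | hKne
  · have hzero : ∀ n : ℕ, maxSep f n ε ≤ 1 := by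
      intro n
      obtain ⟨E, hE, hEcard, -⟩ := exists_isDynSeparated_card_eq_maxSep f.continuous n hε
      rw [← hEcard, Finset.card_le_one]
      intro x hx y hy
      by_contra hne
      obtain ⟨k, -, hlt⟩ := hE x hx y hy hne
      exact absurd (hKε _ (by simp [hK0]) _ (by simp [hK0])) (not_le.2 hlt)
    refine limsup_log_div_log_le_of_le_sum {()} (fun _ => 1) (fun _ _ => 1) _ _
      (fun n => by simpa using hzero n) fun _ _ => ?_
    simp
  obtain ⟨m, hm⟩ := hst.exists_orbitCount_le hK hpK
  have hU : ∀ t : Fin (m + 1) → X, t ∈ Set.pi univ (fun _ => K) → ∃ U : X → Set X,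
      (∀ i, U (t i) ∈ 𝓝 (t i)) ∧
      orbitCount f (⋃ x ∈ Finset.univ.image t, U x) < ⊤ ∧
      codingEntropy ⇑f ((Finset.univ.image t).image U) < c := by
    intro t ht
    have h := hc (Finset.univ.image t) (Finset.univ_nonempty.image t) (by
      intro x hx hxp
      obtain ⟨i, -, rfl⟩ := Finset.mem_image.1 hx
      exact hpK (hxp ▸ ht i (mem_univ i)))
    simp only [localEntropy, iInf_lt_iff] at h
    obtain ⟨U, hUn, hUfin, hlt⟩ := h
    exact ⟨U, fun i => hUn _ (Finset.mem_image_of_mem t (Finset.mem_univ i)), hUfin, hlt⟩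
  choose! U hUn hUfin hUlt using hU
  obtain ⟨T, hTK, hT⟩ := (isCompact_univ_pi fun _ : Fin (m + 1) => hK).elim_nhds_subcover
    (fun t => Set.pi univ fun i => U t (t i))
    fun t ht => set_pi_mem_nhds finite_univ fun i _ => hUn t ht i
  refine limsup_maxSep_le_of_codings f hε hK hKε T
    (fun t => (Finset.univ.image t).image (U t)) (fun t ht => ?_) (fun n x => ?_)
    fun t ht => (hUlt t (hTK t ht)).le
  · have h := hUfin t (hTK t ht)
    rwa [Finset.coe_image, sUnion_image]
  · let J : Finset (Fin n) := Finset.univ.filter fun k => (⇑f)^[(k : ℕ)] x ∈ K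
    have hJ : J.card ≤ m + 1 := by
      have h := (encard_visits_le_orbitCount f K x n).trans hm
      have hJK : {k : Fin n | (⇑f)^[(k : ℕ)] x ∈ K} = J := by
        ext k
        simp [J]
      rw [hJK, Set.encard_coe_eq_coe_finsetCard] at h
      have h' : J.card ≤ m := by exact_mod_cast h
      omega
    obtain ⟨t, htK, ht⟩ := exists_tuple_covering hKne (J.image fun k : Fin n => (⇑f)^[(k : ℕ)] x)
      (by
        intro y hy
        obtain ⟨k, hk, rfl⟩ := Finset.mem_image.1 hy
        exact (Finset.mem_filter.1 hk).2) (Finset.card_image_le.trans hJ)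
    obtain ⟨s, hs, hts⟩ := mem_iUnion₂.1 (hT (fun i _ => htK i : t ∈ Set.pi univ fun _ => K))
    refine ⟨s, hs, fun k hk hkK => ?_⟩
    obtain ⟨i, hi⟩ := ht _ (Finset.mem_image_of_mem _
      (Finset.mem_filter.2 ⟨Finset.mem_univ (⟨k, hk⟩ : Fin n), hkK⟩))
    refine ⟨U s (s i), ?_, ?_⟩
    · exact Finset.mem_coe.2 (Finset.mem_image_of_mem _
        (Finset.mem_image_of_mem _ (Finset.mem_univ i)))
    · have h := hts i (mem_univ i)
      rwa [hi] at h

end Localization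

/-- localization, local form:
`h_pol(f) = sup { h^loc_pol(f; S) : S nonempty finite subset of X ∖ {∞} }`. -/
theorem polEntropy_eq_sup_localEntropy {X : Type*} [MetricSpace X] [CompactSpace X]
    (f : X ≃ₜ X) (p : X) (hst : StandingSetting f p) :
    polEntropy ⇑f =
      ⨆ (S : Finset X) (_ : S.Nonempty ∧ ∀ x ∈ S, x ≠ p),
        localEntropy f S := by
  refine le_antisymm ?_ (iSup₂_le fun S hS => localEntropy_le_polEntropy f hst S hS.2)
  refine iSup₂_le fun ε hε => le_of_forall_gt_imp_ge_of_dense fun c hc => ?_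
  refine limsup_maxSep_le_of_localEntropy_lt f hst hε fun S hS hSp => lt_of_le_of_lt ?_ hc
  exact le_iSup₂ (f := fun (S : Finset X) (_ : S.Nonempty ∧ ∀ x ∈ S, x ≠ p) =>
    localEntropy f S) S ⟨hS, hSp⟩
end

section
/- In the standing setting, for every finite family ℱ of nonempty compact subsets of X∖{∞}, the coding entropy is bounded by the polynomial entropy: h_pol(f; ℱ) ≤ h_pol(f). -/
open Filter Topology Set
open scoped ENNReal

theorem bddAbove_card_dynSeparated {X : Type*} [MetricSpace X] [CompactSpace X] (f : X → X)
    (n : ℕ) {ε : ℝ} (hε : 0 < ε) :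
    BddAbove {m | ∃ E : Finset X, IsDynSeparated f n ε ↑E ∧ E.card = m} := by
  obtain ⟨t, ht, hcov⟩ := Metric.totallyBounded_iff.1
    (isCompact_univ (X := Fin n → X)).totallyBounded (ε / 2) (half_pos hε)
  refine ⟨ht.toFinset.card, ?_⟩
  rintro _ ⟨E, hE, rfl⟩
  have hball : ∀ x : X, ∃ c ∈ t, dist (fun k : Fin n => f^[k] x) c < ε / 2 := fun x => by
    simpa using hcov (mem_univ fun k : Fin n => f^[k] x)
  choose c hct hc using hball
  refine Finset.card_le_card_of_injOn c (fun x _ => by simpa using hct x) ?_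
  intro x hx y hy hxy
  by_contra hne
  obtain ⟨k, hk, hlt⟩ := hE x hx y hy hne
  have hx' := (dist_le_pi_dist (fun k : Fin n => f^[k] x) (c x) ⟨k, hk⟩).trans_lt (hc x)
  have hy' := (dist_le_pi_dist (fun k : Fin n => f^[k] y) (c y) ⟨k, hk⟩).trans_lt (hc y)
  rw [← hxy] at hy'
  have := dist_triangle_right (f^[k] x) (f^[k] y) (c x ⟨k, hk⟩)
  simp only at hx' hy'
  linarith

/-- A maximal `(n, ε)`-separated set is `(n, ε)`-spanning. -/
theorem exists_spanning_card_eq_maxSep {X : Type*} [MetricSpace X] [CompactSpace X] (f : X → X)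
    (n : ℕ) {ε : ℝ} (hε : 0 < ε) :
    ∃ E : Finset X, E.card = maxSep f n ε ∧
      ∀ x, ∃ y ∈ E, ∀ k < n, dist (f^[k] x) (f^[k] y) ≤ ε := by
  classical
  have hbdd := bddAbove_card_dynSeparated f n hε
  obtain ⟨E, hE, hcard⟩ := Nat.sSup_mem (by exact ⟨0, ∅, by simp [IsDynSeparated], rfl⟩) hbdd
  refine ⟨E, hcard, fun x => ?_⟩
  by_contra! h
  have hx : x ∉ E := fun hx => by
    obtain ⟨k, -, hk⟩ := h x hx
    rw [dist_self] at hk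
    exact hk.not_gt hε
  have hsep : IsDynSeparated f n ε ↑(insert x E) := by
    intro a ha b hb hab
    rw [Finset.mem_coe, Finset.mem_insert] at ha hb
    rcases ha with rfl | ha <;> rcases hb with rfl | hb
    · exact absurd rfl hab
    · exact h b hb
    · simpa only [dist_comm] using h a ha
    · exact hE a ha b hb hab
  have hle := le_csSup hbdd ⟨insert x E, hsep, rfl⟩
  rw [Finset.card_insert_of_notMem hx, ← hcard] at hle
  omega

theorem zIter_sub_iterate {X : Type*} [TopologicalSpace X] (f : X ≃ₜ X) (k l : ℕ) (x : X) :
    zIter f ((l : ℤ) - k) (f^[k] x) = f^[l] x := by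
  have h : ∀ j : ℕ, f^[j] x = (f.toEquiv ^ (j : ℤ)) x := fun j => by
    rw [zpow_natCast]
    exact congrFun (Equiv.Perm.iterate_eq_pow f.toEquiv j) x
  rw [h, h, zIter, ← Equiv.Perm.mul_apply, ← zpow_add, sub_add_cancel]

theorem IsWanderingSet.eq_of_iterate_mem {X : Type*} [TopologicalSpace X] {f : X ≃ₜ X}
    {U : Set X} (hU : IsWanderingSet f U) {x : X} {k l : ℕ} (hk : f^[k] x ∈ U)
    (hl : f^[l] x ∈ U) : k = l := by
  by_contra hne
  have h : f^[l] x ∈ zIter f ((l : ℤ) - k) '' U ∩ U :=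
    ⟨⟨_, hk, zIter_sub_iterate f k l x⟩, hl⟩
  rw [hU _ (by omega)] at h
  exact h

/-- A compact set avoiding `p` has an open neighborhood that every forward orbit visits a
uniformly bounded number of times. -/
theorem StandingSetting.exists_open_visits_le {X : Type*} [TopologicalSpace X] {f : X ≃ₜ X}
    {p : X} (hst : StandingSetting f p) {K : Set X} (hK : IsCompact K) (hp : p ∉ K) :
    ∃ V : Set X, IsOpen V ∧ K ⊆ V ∧ ∃ m : ℕ, ∀ (y : X) (T : Finset ℕ),
      (∀ k ∈ T, f^[k] y ∈ V) → T.card ≤ m := by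
  have hU : ∀ x : X, ∃ U : Set X, x ∈ K → U ∈ 𝓝 x ∧ IsWanderingSet f U := fun x => by
    by_cases hx : x ∈ K
    · obtain ⟨U, hU⟩ := hst.2 x (ne_of_mem_of_not_mem hx hp)
      exact ⟨U, fun _ => hU⟩
    · exact ⟨∅, fun h => absurd h hx⟩
  choose U hU using hU
  obtain ⟨t, htK, hcov⟩ := hK.elim_nhds_subcover (fun x => interior (U x))
    fun x hx => interior_mem_nhds.2 (hU x hx).1
  refine ⟨⋃ x ∈ t, interior (U x), isOpen_biUnion fun _ _ => isOpen_interior, hcov, t.card,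
    fun y T hT => ?_⟩
  have hi : ∀ k : ℕ, ∃ x, k ∈ T → x ∈ t ∧ f^[k] y ∈ U x := fun k => by
    by_cases hk : k ∈ T
    · obtain ⟨x, hx, hxy⟩ := mem_iUnion₂.1 (hT k hk)
      exact ⟨x, fun _ => ⟨hx, interior_subset hxy⟩⟩
    · exact ⟨y, fun h => absurd h hk⟩
  choose i hi using hi
  refine Finset.card_le_card_of_injOn i (fun k hk => (hi k hk).1) fun k hk l hl hkl => ?_
  have hl' := (hi l hl).2
  rw [← hkl] at hl'
  exact (hU _ (htK _ (hi k hk).1)).2.eq_of_iterate_mem (hi k hk).2 hl'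

theorem exists_ncard_codings_le_mul_maxSep {X : Type*} [MetricSpace X] [CompactSpace X]
    {f : X ≃ₜ X} {p : X} (hst : StandingSetting f p) {F : Finset (Set X)}
    (hF : ∀ Y ∈ F, IsCompact Y ∧ p ∉ Y) :
    ∃ ε > 0, ∃ C > 0, ∀ n, (codings f F n).ncard ≤ C * maxSep f n ε := by
  classical
  have hK : IsCompact (⋃₀ (F : Set (Set X))) :=
    F.finite_toSet.isCompact_sUnion fun Y hY => (hF Y hY).1
  have hp : p ∉ ⋃₀ (F : Set (Set X)) := fun ⟨Y, hY, hpY⟩ => (hF Y hY).2 hpY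
  obtain ⟨V, hVo, hKV, m, hm⟩ := hst.exists_open_visits_le hK hp
  obtain ⟨ε, hε, hεV⟩ := hK.exists_cthickening_subset_open hVo hKV
  refine ⟨ε, hε, (F.card + 1) ^ m, by positivity, fun n => ?_⟩
  obtain ⟨E, hE, hspan⟩ := exists_spanning_card_eq_maxSep f n hε
  set c : Set X := (⋃₀ (F : Set (Set X)))ᶜ with hc
  let W : X → Finset (Fin n → Set X) := fun y =>
    Fintype.piFinset fun k : Fin n => if f^[k] y ∈ V then insert c F else {c}
  have hsub : codings f F n ⊆ ↑(E.biUnion W) := by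
    rintro w ⟨hw, x, hx⟩
    obtain ⟨y, hy, hxy⟩ := hspan x
    rw [Finset.mem_coe, Finset.mem_biUnion]
    refine ⟨y, hy, Fintype.mem_piFinset.2 fun k => ?_⟩
    rcases hw k with hk | hk
    · have hyV : f^[k] y ∈ V := hεV <| Metric.mem_cthickening_of_dist_le _ (f^[k] x) _ _
        ⟨w k, hk, hx k⟩ (by rw [dist_comm]; exact hxy k k.2)
      simp [hyV, hk]
    · split_ifs <;> simp [hk, ← hc]
  have hW : ∀ y ∈ E, (W y).card ≤ (F.card + 1) ^ m := fun y _ => by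
    let T : Finset (Fin n) := {k | f^[k] y ∈ V}
    have hT : T.card ≤ m := by
      rw [← Finset.card_map Fin.valEmbedding]
      refine hm y _ fun k hk => ?_
      obtain ⟨j, hj, rfl⟩ := Finset.mem_map.1 hk
      exact (Finset.mem_filter.1 hj).2
    calc (W y).card
        = ∏ k : Fin n, (if f^[k] y ∈ V then insert c F else {c}).card :=
          Fintype.card_piFinset _
      _ ≤ ∏ k : Fin n, if f^[k] y ∈ V then F.card + 1 else 1 := by
          refine Finset.prod_le_prod' fun k _ => ?_
          split_ifs
          · exact Finset.card_insert_le _ _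
          · simp
      _ = (F.card + 1) ^ T.card := by
          rw [← Finset.prod_filter, Finset.prod_const]
      _ ≤ (F.card + 1) ^ m := Nat.pow_le_pow_right (Nat.succ_pos _) hT
  calc (codings f F n).ncard
      ≤ (E.biUnion W).card := by
        rw [← Set.ncard_coe_finset]
        exact Set.ncard_le_ncard hsub (Finset.finite_toSet _)
    _ ≤ E.card * (F.card + 1) ^ m := Finset.card_biUnion_le_card_mul _ _ _ hW
    _ = (F.card + 1) ^ m * maxSep f n ε := by rw [hE, mul_comm]

theorem limsup_log_div_log_le_of_le_mul {a b : ℕ → ℕ} {C : ℕ} (hC : 0 < C)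
    (h : ∀ n, a n ≤ C * b n) :
    atTop.limsup (fun n : ℕ => ENNReal.ofReal (Real.log (a n) / Real.log n)) ≤
      atTop.limsup fun n : ℕ => ENNReal.ofReal (Real.log (b n) / Real.log n) := by
  have hlog : ∀ n, Real.log (a n) ≤ Real.log C + Real.log (b n) := fun n => by
    rcases Nat.eq_zero_or_pos (a n) with ha | ha
    · rw [ha, Nat.cast_zero, Real.log_zero]
      exact add_nonneg (Real.log_natCast_nonneg _) (Real.log_natCast_nonneg _)
    · have hb : 0 < b n := Nat.pos_of_mul_pos_left (ha.trans_le (h n))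
      rw [← Real.log_mul (by positivity) (by positivity)]
      exact Real.log_le_log (by positivity) (by exact_mod_cast h n)
  have hzero : Tendsto (fun n : ℕ => ENNReal.ofReal (Real.log C / Real.log n)) atTop (𝓝 0) := by
    rw [← ENNReal.ofReal_zero]
    exact ENNReal.tendsto_ofReal <|
      (Real.tendsto_log_atTop.comp tendsto_natCast_atTop_atTop).const_div_atTop _
  refine (limsup_le_limsup (Eventually.of_forall fun n => ?_)).trans
    (ENNReal.limsup_add_of_left_tendsto_zero hzero _).le
  have hn := Real.log_natCast_nonneg n
  rw [Pi.add_apply, ← ENNReal.ofReal_add (div_nonneg (Real.log_natCast_nonneg _) hn)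
    (div_nonneg (Real.log_natCast_nonneg _) hn), ← add_div]
  exact ENNReal.ofReal_le_ofReal (div_le_div_of_nonneg_right (hlog n) hn)

/-- for every finite family `ℱ` of nonempty compact subsets of `X ∖ {∞}`,
`h_pol(f; ℱ) ≤ h_pol(f)`. -/
theorem codingEntropy_le_polEntropy {X : Type*} [MetricSpace X] [CompactSpace X]
    (f : X ≃ₜ X) (p : X) (hst : StandingSetting f p)
    (F : Finset (Set X))
    (hF : ∀ Y ∈ F, Y.Nonempty ∧ IsCompact Y ∧ p ∉ Y) :
    codingEntropy ⇑f F ≤ polEntropy ⇑f := by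
  obtain ⟨ε, hε, C, hC, h⟩ := exists_ncard_codings_le_mul_maxSep hst fun Y hY => (hF Y hY).2
  exact (limsup_log_div_log_le_of_le_mul hC h).trans (le_iSup₂_of_le ε hε le_rfl)
end
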